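/- Let U be a domain in ℝⁿ (n ≥ 2). The set of supports a' of elements a ∈ ∂_H U is everywhere dense, in the Euclidean metric, in the Euclidean boundary ∂U of U. -/

import Mathlib

open Set Filter Metric Topology ENNReal

noncomputable section

/-- A domain in `ℝⁿ`: a nonempty open connected set. -/
def IsDomainSet {n : ℕ} (U : Set (EuclideanSpace ℝ (Fin n))) : Prop :=
  IsOpen U ∧ IsConnected U

/-- The intrinsic distance inside a set `U`: the infimum of lengths of
(continuous) paths joining `a` and `b` inside `U`. -/
def intrinsicDist {n : ℕ} (U : Set (EuclideanSpace ℝ (Fin n)))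
    (a b : EuclideanSpace ℝ (Fin n)) : ℝ≥0∞ :=
  ⨅ (γ : ℝ → EuclideanSpace ℝ (Fin n)) (_ : ContinuousOn γ (Icc (0:ℝ) 1))
    (_ : γ 0 = a) (_ : γ 1 = b) (_ : ∀ t ∈ Icc (0:ℝ) 1, γ t ∈ U),
    eVariationOn γ (Icc 0 1)

/-- A sequence which is Cauchy with respect to the intrinsic metric `ρ_U`. -/
def IntrinsicCauchy {n : ℕ} (U : Set (EuclideanSpace ℝ (Fin n)))
    (x : ℕ → EuclideanSpace ℝ (Fin n)) : Prop :=
  ∀ ε : ℝ≥0∞, 0 < ε → ∃ N, ∀ m ≥ N, ∀ k ≥ N, intrinsicDist U (x m) (x k) < ε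

/-- An element of the Hausdorff boundary `∂_H U`, represented by a Cauchy
sequence (in the intrinsic metric of `U`) that does not correspond
to a point of `U`. Two such elements with `hDist a b = 0` represent
the same point of `∂_H U`. -/
structure HPoint {n : ℕ} (U : Set (EuclideanSpace ℝ (Fin n))) where
  seq : ℕ → EuclideanSpace ℝ (Fin n)
  mem : ∀ k, seq k ∈ U
  cauchy : IntrinsicCauchy U seq
  not_inner : ¬ ∃ u ∈ U, Tendsto (fun k => intrinsicDist U (seq k) u) atTop (𝓝 0)

/-- The relative metric `ρ_{∂_H U, U}` on the Hausdorff boundary. -/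
def hDist {n : ℕ} {U : Set (EuclideanSpace ℝ (Fin n))} (a b : HPoint U) : ℝ≥0∞ :=
  Filter.liminf (fun k => intrinsicDist U (a.seq k) (b.seq k)) atTop

/-- `f` represents a bijective mapping `∂_H U → ∂_H V` which is a local
isometry in the relative metrics of the Hausdorff boundaries. -/
def HBoundaryLocalIsometry {n : ℕ} {U V : Set (EuclideanSpace ℝ (Fin n))}
    (f : HPoint U → HPoint V) : Prop :=
  (∀ a b : HPoint U, hDist a b = 0 ↔ hDist (f a) (f b) = 0) ∧
  (∀ b : HPoint V, ∃ a : HPoint U, hDist (f a) b = 0) ∧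
  ∀ w : HPoint U, ∃ ε : ℝ≥0∞, 0 < ε ∧ ∀ a b : HPoint U,
    hDist a w < ε → hDist b w < ε → hDist a b = hDist (f a) (f b)

/-- The support of an element of the Hausdorff boundary: the Euclidean limit
of a representing sequence. -/
def hSupport {n : ℕ} {U : Set (EuclideanSpace ℝ (Fin n))} (a : HPoint U) :
    EuclideanSpace ℝ (Fin n) :=
  limUnder atTop a.seq

/-- The length of a path bounds the Euclidean distance of its endpoints. -/
theorem edist_le_intrinsicDist {n : ℕ} (U : Set (EuclideanSpace ℝ (Fin n)))
    (a b : EuclideanSpace ℝ (Fin n)) : edist a b ≤ intrinsicDist U a b := by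
  refine le_iInf fun γ => le_iInf fun _ => le_iInf fun h0 => le_iInf fun h1 => le_iInf fun _ => ?_
  rw [← h0, ← h1]
  exact eVariationOn.edist_le γ (by simp) (by simp)

/-- The intrinsic distance of two points joined by a segment inside `U` is at most Euclidean. -/
theorem intrinsicDist_le_edist {n : ℕ} {U : Set (EuclideanSpace ℝ (Fin n))}
    {a b : EuclideanSpace ℝ (Fin n)} (h : segment ℝ a b ⊆ U) :
    intrinsicDist U a b ≤ edist a b := by
  refine iInf_le_of_le (AffineMap.lineMap a b : ℝ → EuclideanSpace ℝ (Fin n)) <|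
    iInf_le_of_le (AffineMap.lineMap_continuous.continuousOn) <|
    iInf_le_of_le (by simp) <| iInf_le_of_le (by simp) <| iInf_le_of_le ?_ ?_
  · intro t ht
    exact h (segment_eq_image_lineMap ℝ a b ▸ mem_image_of_mem _ ht)
  · have hl : LipschitzOnWith (nndist a b) (AffineMap.lineMap a b : ℝ → _) (Icc (0:ℝ) 1) :=
      (lipschitzWith_lineMap a b).lipschitzOnWith
    have hv := hl.comp_eVariationOn_le (g := fun t : ℝ => t) (s := Icc (0:ℝ) 1) (fun t ht => ht)
    have hid := (monotone_id (α := ℝ)).monotoneOn (Icc (0:ℝ) 1) |>.eVariationOn_eq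
      (a := 0) (b := 1) (by simp) (by simp)
    calc eVariationOn (AffineMap.lineMap a b : ℝ → EuclideanSpace ℝ (Fin n)) (Icc 0 1)
        ≤ (nndist a b : ℝ≥0∞) * eVariationOn (fun t : ℝ => t) (Icc 0 1) := hv
      _ ≤ (nndist a b : ℝ≥0∞) * 1 := by
          gcongr
          simpa [Function.id_def] using hid.le
      _ = edist a b := by rw [mul_one, edist_nndist]

/-- A boundary point of `U` on a sphere whose open ball lies in `U` is the support of an element
of the Hausdorff boundary. -/
theorem exists_hPoint_tendsto_of_ball_subset {n : ℕ} {U : Set (EuclideanSpace ℝ (Fin n))}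
    {x q : EuclideanSpace ℝ (Fin n)} (hq : q ∉ U) (hxq : x ≠ q) (hball : ball x (dist x q) ⊆ U) :
    ∃ a : HPoint U, Tendsto a.seq atTop (𝓝 q) := by
  set s : ℕ → EuclideanSpace ℝ (Fin n) :=
    fun k => AffineMap.lineMap q x (1 / ((k : ℝ) + 1)) with hs
  have hlim : Tendsto s atTop (𝓝 q) := by
    have h := (AffineMap.lineMap_continuous (R := ℝ) (p := q) (q := x)).tendsto 0
    rw [AffineMap.lineMap_apply_zero] at h
    exact h.comp tendsto_one_div_add_atTop_nhds_zero_nat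
  have hmem : ∀ k, s k ∈ ball x (dist x q) := by
    intro k
    have hpos : (0 : ℝ) < 1 / ((k : ℝ) + 1) := by positivity
    have hle : 1 / ((k : ℝ) + 1) ≤ 1 := by
      rw [div_le_one (by positivity)]
      linarith [k.cast_nonneg (α := ℝ)]
    rw [mem_ball, hs, dist_lineMap_right, Real.norm_of_nonneg (by linarith), dist_comm q x]
    nlinarith [dist_pos.2 hxq]
  refine ⟨⟨s, fun k => hball (hmem k), fun ε hε => ?_, ?_⟩, hlim⟩
  · obtain ⟨N, hN⟩ := EMetric.cauchySeq_iff.1 hlim.cauchySeq ε hε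
    exact ⟨N, fun m hm k hk => (intrinsicDist_le_edist
      (((convex_ball x _).segment_subset (hmem m) (hmem k)).trans hball)).trans_lt (hN m hm k hk)⟩
  · rintro ⟨u, hu, hlu⟩
    have hsu : Tendsto s atTop (𝓝 u) := tendsto_iff_edist_tendsto_0.2 <|
      tendsto_of_tendsto_of_tendsto_of_le_of_le tendsto_const_nhds hlu (fun _ => zero_le)
        fun k => edist_le_intrinsicDist U (s k) u
    exact hq (tendsto_nhds_unique hlim hsu ▸ hu)

/-- the set of supports of elements of the Hausdorff boundary of a
domain `U ⊆ ℝⁿ` (`n ≥ 2`) is dense, in the Euclidean metric, in the Euclidean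
boundary of `U`. -/
theorem hausdorff_boundary_supports_dense
    (n : ℕ) (hn : 2 ≤ n)
    (U : Set (EuclideanSpace ℝ (Fin n))) (hU : IsDomainSet U) :
    frontier U ⊆
      closure {p : EuclideanSpace ℝ (Fin n) |
        ∃ a : HPoint U, Tendsto a.seq atTop (𝓝 p)} := by
  intro p hp
  rw [hU.1.frontier_eq] at hp
  refine Metric.mem_closure_iff.2 fun ε hε => ?_
  obtain ⟨x, hxU, hpx⟩ := Metric.mem_closure_iff.1 hp.1 (ε / 2) (by positivity)
  obtain ⟨q, hq, hd⟩ := hU.1.isClosed_compl.exists_infDist_eq_dist ⟨p, hp.2⟩ x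
  have hball : ball x (dist x q) ⊆ U := by
    rw [← hd]
    exact ball_infDist_compl_subset
  have hxq : x ≠ q := fun h => hq (h ▸ hxU)
  refine ⟨q, exists_hPoint_tendsto_of_ball_subset hq hxq hball, ?_⟩
  have hle : dist x q ≤ dist x p := hd ▸ infDist_le_dist_of_mem hp.2
  linarith [dist_triangle p x q, dist_comm x p]

end
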